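/- Let (A, L) be a random financial network and b > 0. Then the systemic risk measure equals the outer risk: ρ_b(A, L) = ρ^O_b(A, L), where ρ^O_b(A, L) = inf{ c ≥ 0 : ρ^I_c(A, L) ≤ b }. -/

import Mathlib

open MeasureTheory

/-- Total liability vector: `ℓ̄_i = ∑_j ℓ_{ij}`. -/
noncomputable def lbar {N : ℕ} (ℓ : Fin N → Fin N → ℝ) : Fin N → ℝ := fun i => ∑ j, ℓ i j

/-- Relative liability matrix: `π_{ij} = ℓ_{ij}/ℓ̄_i` if `ℓ̄_i > 0`, else `0`. -/
noncomputable def relPi {N : ℕ} (ℓ : Fin N → Fin N → ℝ) : Fin N → Fin N → ℝ :=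
  fun i j => if 0 < lbar ℓ i then ℓ i j / lbar ℓ i else 0

/-- The Eisenberg–Noe clearing map `Φ(p, a, π, ℓ̄) = (πᵀp + a) ∧ ℓ̄`. -/
noncomputable def Phi {N : ℕ} (π : Fin N → Fin N → ℝ) (a lb p : Fin N → ℝ) : Fin N → ℝ :=
  fun i => min ((∑ j, π j i * p j) + a i) (lb i)

/-- The clearing vector `CV(a, ℓ)`: the (for `a ∈ ℝ^N_{++}` unique) nonnegative fixed
point of the clearing map associated with the liability matrix `ℓ`. -/
noncomputable def clearingVec {N : ℕ} (a : Fin N → ℝ) (ℓ : Fin N → Fin N → ℝ) : Fin N → ℝ :=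
  Classical.epsilon fun p => (∀ i, 0 ≤ p i) ∧ Phi (relPi ℓ) a (lbar ℓ) p = p

/-- The Eisenberg–Noe aggregation function `Λ(a, ℓ) = ∑_i (ℓ̄_i − CV_i(a, ℓ))`. -/
noncomputable def aggLoss {N : ℕ} (a : Fin N → ℝ) (ℓ : Fin N → Fin N → ℝ) : ℝ :=
  ∑ i, (lbar ℓ i - clearingVec a ℓ i)

/-- The feasible total bailout-capital levels: constants `c` such that some admissible
random allocation `Y ∈ 𝒞` with `∑ᵢ Yᵢ = c` a.s. makes the system acceptable. -/
noncomputable def feas {Ω : Type*} [MeasurableSpace Ω] (P : Measure Ω) {N : ℕ}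
    (η : (Ω → ℝ) → ℝ) (A : Ω → Fin N → ℝ) (L : Ω → Fin N → Fin N → ℝ) (b : ℝ) : Set ℝ :=
  {c : ℝ | ∃ Y : Ω → Fin N → ℝ, Measurable Y ∧ (∀ ω i, 0 ≤ Y ω i) ∧
    (∀ᵐ ω ∂P, ∑ i, Y ω i = c) ∧
    η (fun ω => aggLoss (fun i => A ω i + Y ω i) (L ω)) ≤ b}

/-- The systemic risk measure `ρ_b(A, L)`. -/
noncomputable def sysRisk {Ω : Type*} [MeasurableSpace Ω] (P : Measure Ω) {N : ℕ}
    (η : (Ω → ℝ) → ℝ) (A : Ω → Fin N → ℝ) (L : Ω → Fin N → Fin N → ℝ) (b : ℝ) : ℝ :=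
  sInf (feas P η A L b)

/-- The inner risk `ρ^I_c(A, L) = inf_{Y ∈ 𝒞^c} η(Λ(A+Y, L))`. -/
noncomputable def innerRisk {Ω : Type*} [MeasurableSpace Ω] (P : Measure Ω) {N : ℕ}
    (η : (Ω → ℝ) → ℝ) (A : Ω → Fin N → ℝ) (L : Ω → Fin N → Fin N → ℝ) (c : ℝ) : ℝ :=
  sInf {r : ℝ | ∃ Y : Ω → Fin N → ℝ, Measurable Y ∧ (∀ ω i, 0 ≤ Y ω i) ∧
    (∀ᵐ ω ∂P, ∑ i, Y ω i = c) ∧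
    r = η (fun ω => aggLoss (fun i => A ω i + Y ω i) (L ω))}

/-- The outer risk `ρ^O_b(A, L) = inf{c ≥ 0 : ρ^I_c(A, L) ≤ b}`. -/
noncomputable def outerRisk {Ω : Type*} [MeasurableSpace Ω] (P : Measure Ω) {N : ℕ}
    (η : (Ω → ℝ) → ℝ) (A : Ω → Fin N → ℝ) (L : Ω → Fin N → Fin N → ℝ) (b : ℝ) : ℝ :=
  sInf {c : ℝ | 0 ≤ c ∧ innerRisk P η A L c ≤ b}

open Filter Topology

section EisenbergNoe

variable {N : ℕ}

lemma relPi_nonneg {ℓ : Fin N → Fin N → ℝ} (hℓ : ∀ i j, 0 ≤ ℓ i j) (i j : Fin N) :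
    0 ≤ relPi ℓ i j := by
  unfold relPi
  split_ifs with h
  · exact div_nonneg (hℓ i j) h.le
  · exact le_rfl

lemma sum_relPi_le_one (ℓ : Fin N → Fin N → ℝ) (i : Fin N) : ∑ j, relPi ℓ i j ≤ 1 := by
  unfold relPi
  split_ifs with h
  · rw [← Finset.sum_div]
    exact (div_self h.ne').le
  · simp

lemma lbar_nonneg {ℓ : Fin N → Fin N → ℝ} (hℓ : ∀ i j, 0 ≤ ℓ i j) (i : Fin N) :
    0 ≤ lbar ℓ i :=
  Finset.sum_nonneg fun j _ => hℓ i j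

lemma Phi_mono {π : Fin N → Fin N → ℝ} (hπ : ∀ i j, 0 ≤ π i j) (a lb : Fin N → ℝ) :
    Monotone (Phi π a lb) := fun p q hpq i => by
  unfold Phi
  gcongr with j
  · exact hπ j i
  · exact hpq j

lemma continuous_Phi (π : Fin N → Fin N → ℝ) (a lb : Fin N → ℝ) : Continuous (Phi π a lb) := by
  unfold Phi
  fun_prop

/-- Every sub-fixed point of the clearing map lies below every nonnegative fixed point. -/
lemma le_of_le_Phi {π : Fin N → Fin N → ℝ} {a lb p q : Fin N → ℝ}
    (hπ : ∀ i j, 0 ≤ π i j) (hπ1 : ∀ i, ∑ j, π i j ≤ 1) (ha : ∀ i, 0 < a i)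
    (hp : ∀ i, 0 ≤ p i) (hfix : Phi π a lb p = p) (hq : q ≤ Phi π a lb q) : q ≤ p := by
  classical
  by_contra hne
  obtain ⟨k, hk⟩ : ∃ k, p k < q k := by
    by_contra! h
    exact hne h
  set S : Finset (Fin N) := Finset.univ.filter fun i => p i < q i with hS
  have hkS : k ∈ S := by simp [hS, hk]
  have mem {i : Fin N} (hi : i ∈ S) : p i < q i := by simpa [hS] using hi
  have p_eq {i : Fin N} (hi : i ∈ S) : p i = (∑ j, π j i * p j) + a i := by
    have h1 : min ((∑ j, π j i * p j) + a i) (lb i) = p i := congrFun hfix i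
    have h2 : q i ≤ lb i := (hq i).trans (min_le_right _ _)
    rcases min_choice ((∑ j, π j i * p j) + a i) (lb i) with h | h
    · rw [← h1, h]
    · linarith [mem hi]
  have diff_le {i : Fin N} (hi : i ∈ S) : q i - p i ≤ ∑ j ∈ S, π j i * (q j - p j) := by
    have h2 : q i ≤ (∑ j, π j i * q j) + a i := (hq i).trans (min_le_left _ _)
    have h3 : ∑ j, π j i * (q j - p j) ≤ ∑ j ∈ S, π j i * (q j - p j) := by
      rw [hS, Finset.sum_filter]
      refine Finset.sum_le_sum fun j _ => ?_
      split_ifs with h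
      · exact le_rfl
      · exact mul_nonpos_of_nonneg_of_nonpos (hπ j i) (by linarith)
    simp only [mul_sub, Finset.sum_sub_distrib] at h3 ⊢
    linarith [p_eq hi]
  have row_le (j : Fin N) : ∑ i ∈ S, π j i ≤ 1 :=
    (Finset.sum_le_univ_sum_of_nonneg fun i => hπ j i).trans (hπ1 j)
  have sum_diff : ∑ j ∈ S, (q j - p j) ≤ ∑ j ∈ S, (∑ i ∈ S, π j i) * (q j - p j) := by
    calc _ ≤ ∑ i ∈ S, ∑ j ∈ S, π j i * (q j - p j) := Finset.sum_le_sum fun i hi => diff_le hi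
      _ = _ := by
        rw [Finset.sum_comm]
        simp only [Finset.sum_mul]
  have row_eq {j : Fin N} (hj : j ∈ S) : ∑ i ∈ S, π j i = 1 := by
    by_contra h
    have hlt : ∑ i ∈ S, π j i < 1 := lt_of_le_of_ne (row_le j) h
    refine sum_diff.not_gt (Finset.sum_lt_sum (fun i hi => ?_) ⟨j, hj, ?_⟩)
    · nlinarith [row_le i, mem hi]
    · nlinarith [mem hj]
  have sum_p : ∑ i ∈ S, p i = (∑ i ∈ S, ∑ j, π j i * p j) + ∑ i ∈ S, a i := by
    rw [← Finset.sum_add_distrib]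
    exact Finset.sum_congr rfl fun i hi => p_eq hi
  have inflow : ∑ j ∈ S, p j ≤ ∑ i ∈ S, ∑ j, π j i * p j := by
    calc ∑ j ∈ S, p j = ∑ j ∈ S, ∑ i ∈ S, π j i * p j :=
          Finset.sum_congr rfl fun j hj => by rw [← Finset.sum_mul, row_eq hj, one_mul]
      _ = ∑ i ∈ S, ∑ j ∈ S, π j i * p j := Finset.sum_comm
      _ ≤ _ := Finset.sum_le_sum fun i _ =>
          Finset.sum_le_univ_sum_of_nonneg fun j => mul_nonneg (hπ j i) (hp j)
  have : 0 < ∑ i ∈ S, a i := Finset.sum_pos (fun i _ => ha i) ⟨k, hkS⟩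
  linarith

/-- Iterating the clearing map from the total liabilities converges to a nonnegative fixed
point. -/
lemma exists_tendsto_iterate_Phi {π : Fin N → Fin N → ℝ} {a lb : Fin N → ℝ}
    (hπ : ∀ i j, 0 ≤ π i j) (ha : ∀ i, 0 < a i) (hlb : ∀ i, 0 ≤ lb i) :
    ∃ p : Fin N → ℝ, (∀ i, 0 ≤ p i) ∧ Phi π a lb p = p ∧
      Tendsto (fun n => (Phi π a lb)^[n] lb) atTop (𝓝 p) := by
  have hanti : Antitone fun n => (Phi π a lb)^[n] lb :=
    (Phi_mono hπ a lb).antitone_iterate_of_map_le fun i => min_le_right _ _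
  have hnn (n : ℕ) : 0 ≤ (Phi π a lb)^[n] lb := by
    induction n with
    | zero => exact hlb
    | succ n ih =>
      rw [Function.iterate_succ_apply']
      refine fun i => le_min (add_nonneg ?_ (ha i).le) (hlb i)
      exact Finset.sum_nonneg fun j _ => mul_nonneg (hπ j i) (ih j)
  have hlim := tendsto_atTop_ciInf hanti ⟨0, by rintro _ ⟨n, rfl⟩; exact hnn n⟩
  refine ⟨_, fun i => ?_, isFixedPt_of_tendsto_iterate hlim (continuous_Phi π a lb).continuousAt,
    hlim⟩
  exact ge_of_tendsto' hlim hnn i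

variable {a : Fin N → ℝ} {ℓ : Fin N → Fin N → ℝ}

lemma clearingVec_spec (ha : ∀ i, 0 < a i) (hℓ : ∀ i j, 0 ≤ ℓ i j) :
    (∀ i, 0 ≤ clearingVec a ℓ i) ∧
      Phi (relPi ℓ) a (lbar ℓ) (clearingVec a ℓ) = clearingVec a ℓ := by
  obtain ⟨p, hp, hfix, -⟩ := exists_tendsto_iterate_Phi (relPi_nonneg hℓ) ha (lbar_nonneg hℓ)
  exact Classical.epsilon_spec
    (p := fun p => (∀ i, 0 ≤ p i) ∧ Phi (relPi ℓ) a (lbar ℓ) p = p) ⟨p, hp, hfix⟩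

lemma le_clearingVec (ha : ∀ i, 0 < a i) (hℓ : ∀ i j, 0 ≤ ℓ i j) {q : Fin N → ℝ}
    (hq : q ≤ Phi (relPi ℓ) a (lbar ℓ) q) : q ≤ clearingVec a ℓ :=
  le_of_le_Phi (relPi_nonneg hℓ) (sum_relPi_le_one ℓ) ha (clearingVec_spec ha hℓ).1
    (clearingVec_spec ha hℓ).2 hq

lemma clearingVec_le_lbar (ha : ∀ i, 0 < a i) (hℓ : ∀ i j, 0 ≤ ℓ i j) (i : Fin N) :
    clearingVec a ℓ i ≤ lbar ℓ i := by
  rw [← (clearingVec_spec ha hℓ).2]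
  exact min_le_right _ _

lemma tendsto_iterate_clearingVec (ha : ∀ i, 0 < a i) (hℓ : ∀ i j, 0 ≤ ℓ i j) :
    Tendsto (fun n => (Phi (relPi ℓ) a (lbar ℓ))^[n] (lbar ℓ)) atTop
      (𝓝 (clearingVec a ℓ)) := by
  obtain ⟨p, hp, hfix, hlim⟩ :=
    exists_tendsto_iterate_Phi (relPi_nonneg hℓ) ha (lbar_nonneg hℓ)
  have : p = clearingVec a ℓ := le_antisymm (le_clearingVec ha hℓ hfix.ge)
    (le_of_le_Phi (relPi_nonneg hℓ) (sum_relPi_le_one ℓ) ha hp hfix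
      (clearingVec_spec ha hℓ).2.ge)
  exact this ▸ hlim

lemma aggLoss_nonneg (ha : ∀ i, 0 < a i) (hℓ : ∀ i j, 0 ≤ ℓ i j) : 0 ≤ aggLoss a ℓ :=
  Finset.sum_nonneg fun i _ => sub_nonneg.2 (clearingVec_le_lbar ha hℓ i)

lemma aggLoss_le (ha : ∀ i, 0 < a i) (hℓ : ∀ i j, 0 ≤ ℓ i j) :
    aggLoss a ℓ ≤ ∑ i, ∑ j, ℓ i j :=
  Finset.sum_le_sum fun i _ => sub_le_self _ ((clearingVec_spec ha hℓ).1 i)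

lemma aggLoss_eq_zero (ha : ∀ i, 0 < a i) (hℓ : ∀ i j, 0 ≤ ℓ i j)
    (h : ∀ i, lbar ℓ i ≤ a i) : aggLoss a ℓ = 0 := by
  refine Finset.sum_eq_zero fun i _ => sub_eq_zero.2 (le_antisymm ?_ ?_)
  · refine le_clearingVec ha hℓ (fun i => le_min ?_ le_rfl) i
    have : 0 ≤ ∑ j, relPi ℓ j i * lbar ℓ j :=
      Finset.sum_nonneg fun j _ => mul_nonneg (relPi_nonneg hℓ j i) (lbar_nonneg hℓ j)
    linarith [h i]
  · exact clearingVec_le_lbar ha hℓ i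

/-- The aggregation function is convex in the capital vector. -/
lemma aggLoss_convex {a' : Fin N → ℝ} (ha : ∀ i, 0 < a i) (ha' : ∀ i, 0 < a' i)
    (hℓ : ∀ i j, 0 ≤ ℓ i j) {t : ℝ} (ht0 : 0 ≤ t) (ht1 : t ≤ 1)
    (hc : ∀ i, 0 < t * a i + (1 - t) * a' i) :
    aggLoss (fun i => t * a i + (1 - t) * a' i) ℓ ≤ t * aggLoss a ℓ + (1 - t) * aggLoss a' ℓ := by
  have key : (fun i => t * clearingVec a ℓ i + (1 - t) * clearingVec a' ℓ i) ≤
      clearingVec (fun i => t * a i + (1 - t) * a' i) ℓ := by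
    refine le_clearingVec hc hℓ fun i => ?_
    have h1 := (clearingVec_spec ha hℓ).2.ge i
    have h2 := (clearingVec_spec ha' hℓ).2.ge i
    obtain ⟨h1l, h1r⟩ := le_min_iff.1 h1
    obtain ⟨h2l, h2r⟩ := le_min_iff.1 h2
    refine le_min ?_ ?_
    · have hsum : ∑ j, relPi ℓ j i * (t * clearingVec a ℓ j + (1 - t) * clearingVec a' ℓ j) =
          t * ∑ j, relPi ℓ j i * clearingVec a ℓ j +
            (1 - t) * ∑ j, relPi ℓ j i * clearingVec a' ℓ j := by
        rw [Finset.mul_sum, Finset.mul_sum, ← Finset.sum_add_distrib]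
        exact Finset.sum_congr rfl fun j _ => by ring
      rw [hsum]
      linarith [mul_le_mul_of_nonneg_left h1l ht0,
        mul_le_mul_of_nonneg_left h2l (sub_nonneg.2 ht1)]
    · linarith [mul_le_mul_of_nonneg_left h1r ht0,
        mul_le_mul_of_nonneg_left h2r (sub_nonneg.2 ht1)]
  unfold aggLoss
  rw [Finset.mul_sum, Finset.mul_sum, ← Finset.sum_add_distrib]
  refine Finset.sum_le_sum fun i _ => ?_
  linarith [key i]

end EisenbergNoe

section RandomNetwork

variable {Ω : Type*} [MeasurableSpace Ω] {N : ℕ} {A : Ω → Fin N → ℝ}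
  {L : Ω → Fin N → Fin N → ℝ}

lemma measurable_aggLoss (hA : Measurable A) (hApos : ∀ ω i, 0 < A ω i) (hL : Measurable L)
    (hLnn : ∀ ω i j, 0 ≤ L ω i j) : Measurable fun ω => aggLoss (A ω) (L ω) := by
  have hLij (i j : Fin N) : Measurable fun ω => L ω i j := by fun_prop
  have hlb (i : Fin N) : Measurable fun ω => lbar (L ω) i :=
    Finset.measurable_sum _ fun j _ => hLij i j
  have hpi (i j : Fin N) : Measurable fun ω => relPi (L ω) i j :=
    Measurable.ite (measurableSet_lt measurable_const (hlb i)) ((hLij i j).div (hlb i))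
      measurable_const
  have hiter (n : ℕ) : Measurable fun ω =>
      (Phi (relPi (L ω)) (A ω) (lbar (L ω)))^[n] (lbar (L ω)) := by
    induction n with
    | zero => exact measurable_pi_lambda _ hlb
    | succ n ih =>
      simp only [Function.iterate_succ_apply']
      refine measurable_pi_lambda _ fun i => Measurable.min (Measurable.add ?_ ?_) (hlb i)
      · exact Finset.measurable_sum _ fun j _ => (hpi j i).mul ((measurable_pi_apply j).comp ih)
      · exact (measurable_pi_apply i).comp hA
  have hcv : Measurable fun ω => clearingVec (A ω) (L ω) :=
    measurable_of_tendsto_metrizable hiter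
      (tendsto_pi_nhds.2 fun ω => tendsto_iterate_clearingVec (hApos ω) (hLnn ω))
  exact Finset.measurable_sum _ fun i _ => (hlb i).sub ((measurable_pi_apply i).comp hcv)

lemma integrable_aggLoss {P : Measure Ω} (hA : Measurable A) (hApos : ∀ ω i, 0 < A ω i)
    (hL : Measurable L) (hLnn : ∀ ω i j, 0 ≤ L ω i j)
    (hLint : Integrable (fun ω => ∑ i, ∑ j, L ω i j) P) :
    Integrable (fun ω => aggLoss (A ω) (L ω)) P := by
  refine hLint.mono' (measurable_aggLoss hA hApos hL hLnn).aestronglyMeasurable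
    (ae_of_all _ fun ω => ?_)
  rw [Real.norm_of_nonneg (aggLoss_nonneg (hApos ω) (hLnn ω))]
  exact aggLoss_le (hApos ω) (hLnn ω)

/-- A large deterministic bailout makes the expected loss vanish. -/
lemma tendsto_integral_aggLoss_add_const {P : Measure Ω} (hA : Measurable A)
    (hApos : ∀ ω i, 0 < A ω i) (hL : Measurable L) (hLnn : ∀ ω i j, 0 ≤ L ω i j)
    (hLint : Integrable (fun ω => ∑ i, ∑ j, L ω i j) P) :
    Tendsto (fun n : ℕ => ∫ ω, aggLoss (fun i => A ω i + n) (L ω) ∂P) atTop (𝓝 0) := by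
  have hpos (n : ℕ) (ω : Ω) (i : Fin N) : 0 < A ω i + n :=
    add_pos_of_pos_of_nonneg (hApos ω i) n.cast_nonneg
  have hmeas (n : ℕ) : Measurable fun ω i => A ω i + n := by fun_prop
  rw [← integral_zero Ω ℝ (μ := P)]
  refine tendsto_integral_of_dominated_convergence _
    (fun n => (measurable_aggLoss (hmeas n) (hpos n) hL hLnn).aestronglyMeasurable) hLint
    (fun n => ae_of_all _ fun ω => ?_) (ae_of_all _ fun ω => ?_)
  · rw [Real.norm_of_nonneg (aggLoss_nonneg (hpos n ω) (hLnn ω))]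
    exact aggLoss_le (hpos n ω) (hLnn ω)
  · have hev : ∀ᶠ n : ℕ in atTop, ∀ i, lbar (L ω) i ≤ n :=
      eventually_all.2 fun i => tendsto_natCast_atTop_atTop.eventually_ge_atTop _
    refine tendsto_const_nhds.congr' (hev.mono fun n hn => ?_)
    exact (aggLoss_eq_zero (hpos n ω) (hLnn ω) fun i => by linarith [hn i, hApos ω i]).symm

end RandomNetwork

/-- The systemic risk measure equals the outer risk:
`ρ_b(A, L) = ρ^O_b(A, L)`. -/
theorem sysRisk_eq_outerRisk
    {Ω : Type*} [MeasurableSpace Ω] (P : Measure Ω) [IsProbabilityMeasure P]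
    (N : ℕ) (hN : 1 ≤ N)
    (η : (Ω → ℝ) → ℝ)
    (hη_mono : ∀ X Y : Ω → ℝ, Integrable X P → Integrable Y P →
      (∀ᵐ ω ∂P, X ω ≤ Y ω) → η X ≤ η Y)
    (hη_conv : ∀ X Y : Ω → ℝ, Integrable X P → Integrable Y P → ∀ t : ℝ, 0 ≤ t → t ≤ 1 →
      η (fun ω => t * X ω + (1 - t) * Y ω) ≤ t * η X + (1 - t) * η Y)
    (hη_norm : η (fun _ => 0) = 0)
    (hη_cont : ∀ ε : ℝ, 0 < ε → ∃ δ : ℝ, 0 < δ ∧ ∀ X Y : Ω → ℝ,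
      Integrable X P → Integrable Y P → (∫ ω, |X ω - Y ω| ∂P) < δ → |η X - η Y| < ε)
    (A : Ω → Fin N → ℝ) (hA : Measurable A) (hApos : ∀ ω i, 0 < A ω i)
    (L : Ω → Fin N → Fin N → ℝ) (hL : Measurable L)
    (hLnn : ∀ ω i j, 0 ≤ L ω i j) (hLdiag : ∀ ω i, L ω i i = 0)
    (hLint : Integrable (fun ω => ∑ i, ∑ j, L ω i j) P)
    (b : ℝ) (hb : 0 < b)
    :
    sysRisk P η A L b = outerRisk P η A L b := by
  have hmeas {Y : Ω → Fin N → ℝ} (hY : Measurable Y) : Measurable fun ω i => A ω i + Y ω i := by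
    fun_prop
  have hpos {Y : Ω → Fin N → ℝ} (hY : ∀ ω i, 0 ≤ Y ω i) (ω : Ω) (i : Fin N) :
      0 < A ω i + Y ω i := add_pos_of_pos_of_nonneg (hApos ω i) (hY ω i)
  have hint {Y : Ω → Fin N → ℝ} (hYm : Measurable Y) (hY : ∀ ω i, 0 ≤ Y ω i) :
      Integrable (fun ω => aggLoss (fun i => A ω i + Y ω i) (L ω)) P :=
    integrable_aggLoss (hmeas hYm) (hpos hY) hL hLnn hLint
  have hη_nonneg {Y : Ω → Fin N → ℝ} (hYm : Measurable Y) (hY : ∀ ω i, 0 ≤ Y ω i) :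
      0 ≤ η fun ω => aggLoss (fun i => A ω i + Y ω i) (L ω) :=
    hη_norm ▸ hη_mono _ _ (integrable_zero Ω ℝ P) (hint hYm hY)
      (ae_of_all _ fun ω => aggLoss_nonneg (hpos hY ω) (hLnn ω))
  have hsub : feas P η A L b ⊆ {c : ℝ | 0 ≤ c ∧ innerRisk P η A L c ≤ b} := by
    rintro c ⟨Y, hYm, hY, hYc, hYb⟩
    obtain ⟨ω, hω⟩ := hYc.exists
    refine ⟨hω ▸ Finset.sum_nonneg fun i _ => hY ω i, le_trans ?_ hYb⟩
    unfold innerRisk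
    refine csInf_le ⟨0, ?_⟩ ⟨Y, hYm, hY, hYc, rfl⟩
    rintro _ ⟨Z, hZm, hZ, -, rfl⟩
    exact hη_nonneg hZm hZ
  obtain ⟨n, hn⟩ : ∃ n : ℕ, η (fun ω => aggLoss (fun i => A ω i + n) (L ω)) ≤ b / 2 := by
    obtain ⟨δ, hδ, hcont⟩ := hη_cont (b / 2) (half_pos hb)
    obtain ⟨n, hn⟩ := ((tendsto_integral_aggLoss_add_const hA hApos hL hLnn
      hLint).eventually_lt_const hδ).exists
    have hZ : ∀ (ω : Ω) (i : Fin N), (0 : ℝ) ≤ n := fun _ _ => n.cast_nonneg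
    have h := hcont _ _ (hint (Y := fun _ _ => (n : ℝ)) measurable_const hZ)
      (integrable_zero Ω ℝ P) (by
        simpa only [Pi.zero_apply, sub_zero,
          abs_of_nonneg (aggLoss_nonneg (hpos hZ _) (hLnn _))] using hn)
    have h0 : η (0 : Ω → ℝ) = 0 := hη_norm
    rw [h0, sub_zero] at h
    exact ⟨n, (le_abs_self _).trans h.le⟩
  set d : ℝ := N * n
  have hmix {c t : ℝ} (hc0 : 0 ≤ c) (hc : innerRisk P η A L c ≤ b) (ht0 : 0 ≤ t) (ht1 : t < 1) :
      t * c + (1 - t) * d ∈ feas P η A L b := by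
    have hlt : innerRisk P η A L c < b + (1 - t) * (b / 2) :=
      hc.trans_lt (lt_add_of_pos_right _ (mul_pos (sub_pos.2 ht1) (half_pos hb)))
    unfold innerRisk at hlt
    obtain ⟨_, ⟨Y, hYm, hY, hYc, rfl⟩, hYb⟩ := exists_lt_of_csInf_lt
      (by exact ⟨_, fun _ i => if i = ⟨0, hN⟩ then c else 0, measurable_const,
        fun _ i => by dsimp only; split_ifs <;> simp [hc0], by simp, rfl⟩) hlt
    have hZ : ∀ (ω : Ω) (i : Fin N), (0 : ℝ) ≤ n := fun _ _ => n.cast_nonneg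
    have hWm : Measurable fun ω i => t * Y ω i + (1 - t) * n := by fun_prop
    have hW : ∀ (ω : Ω) (i : Fin N), 0 ≤ t * Y ω i + (1 - t) * n := fun ω i =>
      add_nonneg (mul_nonneg ht0 (hY ω i)) (mul_nonneg (sub_nonneg.2 ht1.le) (hZ ω i))
    have hIY := hint hYm hY
    have hIZ := hint (Y := fun _ _ => (n : ℝ)) measurable_const hZ
    refine ⟨_, hWm, hW, hYc.mono fun ω hω => ?_, ?_⟩
    · rw [Finset.sum_add_distrib, ← Finset.mul_sum, hω]
      simp only [Finset.sum_const, Finset.card_univ, Fintype.card_fin, nsmul_eq_mul, d]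
      ring
    · have hle := (hη_mono _ _ (hint hWm hW) ((hIY.const_mul t).add (hIZ.const_mul (1 - t)))
        (ae_of_all _ fun ω => ?_)).trans (hη_conv _ _ hIY hIZ t ht0 ht1.le)
      · nlinarith [mul_le_mul_of_nonneg_left hYb.le ht0,
          mul_le_mul_of_nonneg_left hn (sub_nonneg.2 ht1.le), mul_pos (sub_pos.2 ht1) hb,
          mul_nonneg (sub_nonneg.2 ht1.le) (mul_pos (sub_pos.2 ht1) hb).le]
      · have heq : (fun i => A ω i + (t * Y ω i + (1 - t) * n)) =
            fun i => t * (A ω i + Y ω i) + (1 - t) * (A ω i + n) := by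
          funext i
          ring
        have hpW := hpos hW ω
        have hc := aggLoss_convex (hpos hY ω) (hpos hZ ω) (hLnn ω) ht0 ht1.le fun i =>
          congrFun heq i ▸ hpW i
        rwa [← heq] at hc
  have hbdd : BddBelow {c : ℝ | 0 ≤ c ∧ innerRisk P η A L c ≤ b} := ⟨0, fun c hc => hc.1⟩
  have hd : d ∈ feas P η A L b := by
    refine ⟨fun _ _ => n, measurable_const, fun _ _ => n.cast_nonneg, by simp [d], ?_⟩
    exact hn.trans (half_le_self hb.le)
  refine le_antisymm (le_csInf ⟨d, hsub hd⟩ fun c hc => ?_) (csInf_le_csInf hbdd ⟨d, hd⟩ hsub)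
  have hlim : Tendsto (fun t : ℝ => t * c + (1 - t) * d) (𝓝[<] 1) (𝓝 c) := by
    have : Continuous fun t : ℝ => t * c + (1 - t) * d := by fun_prop
    simpa using (this.tendsto 1).mono_left nhdsWithin_le_nhds
  refine ge_of_tendsto hlim ?_
  filter_upwards [Ioo_mem_nhdsLT (zero_lt_one' ℝ)] with t ht
  exact csInf_le (hbdd.mono hsub) (hmix hc.1 hc.2 ht.1.le ht.2)
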